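/- Let λ : ℝ → ℝ be smooth and everywhere positive, and set φ₁(s) := sech⁴(s). Then the function t ↦ (1/2) ∫_ℝ φ₁(x/λ(t)) ((∂ₓu₁)² + u₁² + u₂² − 2F(u₁))(t,x) dx is differentiable, with derivative equal to −(λ'(t)/(2λ(t))) ∫ (x/λ(t)) φ₁'(x/λ(t)) ((∂ₓu₁)² + u₁² + u₂² − 2F(u₁)) dx + (2/λ(t)) ∫ φ₁'(x/λ(t)) u₂ ∂ₓ²u₁ dx + (1/λ(t)²) ∫ φ₁''(x/λ(t)) ∂ₓu₁ u₂ dx − (1/λ(t)) ∫ φ₁'(x/λ(t)) u₁ u₂ dx + (1/λ(t)) ∫ φ₁'(x/λ(t)) u₂ f(u₁) dx, where all integrals are over x ∈ ℝ at time t. -/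

import Mathlib

open MeasureTheory Filter

noncomputable def sech (x : ℝ) : ℝ := 1 / Real.cosh x

section JointlySmooth

variable {G : ℝ → ℝ → ℝ}

lemma hasDerivAt_snd_fderiv (hG : ContDiff ℝ (⊤ : ℕ∞) (fun q : ℝ × ℝ => G q.1 q.2)) (t x : ℝ) :
    HasDerivAt (G t) (fderiv ℝ (fun q : ℝ × ℝ => G q.1 q.2) (t, x) (0, 1)) x :=
  ((hG.differentiable (by simp)) (t, x)).hasFDerivAt.comp_hasDerivAt x
    ((hasDerivAt_const x t).prodMk (hasDerivAt_id x))

lemma hasDerivAt_fst_fderiv (hG : ContDiff ℝ (⊤ : ℕ∞) (fun q : ℝ × ℝ => G q.1 q.2)) (t x : ℝ) :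
    HasDerivAt (fun s => G s x) (fderiv ℝ (fun q : ℝ × ℝ => G q.1 q.2) (t, x) (1, 0)) t :=
  HasFDerivAt.comp_hasDerivAt (f := fun s => (s, x)) t
    ((hG.differentiable (by simp)) (t, x)).hasFDerivAt ((hasDerivAt_id t).prodMk (hasDerivAt_const t x))

lemma contDiff_fderiv_apply (hG : ContDiff ℝ (⊤ : ℕ∞) (fun q : ℝ × ℝ => G q.1 q.2)) (v : ℝ × ℝ) :
    ContDiff ℝ (⊤ : ℕ∞) (fun q : ℝ × ℝ => fderiv ℝ (fun q : ℝ × ℝ => G q.1 q.2) q v) :=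
  (hG.fderiv_right (by simp)).clm_apply contDiff_const

lemma contDiff_deriv_snd (hG : ContDiff ℝ (⊤ : ℕ∞) (fun q : ℝ × ℝ => G q.1 q.2)) :
    ContDiff ℝ (⊤ : ℕ∞) (fun q : ℝ × ℝ => deriv (G q.1) q.2) := by
  simpa only [(hasDerivAt_snd_fderiv hG _ _).deriv] using contDiff_fderiv_apply hG (0, 1)

lemma contDiff_deriv_fst (hG : ContDiff ℝ (⊤ : ℕ∞) (fun q : ℝ × ℝ => G q.1 q.2)) :
    ContDiff ℝ (⊤ : ℕ∞) (fun q : ℝ × ℝ => deriv (fun s => G s q.2) q.1) := by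
  simpa only [(hasDerivAt_fst_fderiv hG _ _).deriv] using contDiff_fderiv_apply hG (1, 0)

lemma hasDerivAt_snd (hG : ContDiff ℝ (⊤ : ℕ∞) (fun q : ℝ × ℝ => G q.1 q.2)) (t x : ℝ) :
    HasDerivAt (G t) (deriv (G t) x) x :=
  (hasDerivAt_snd_fderiv hG t x).differentiableAt.hasDerivAt

lemma hasDerivAt_fst (hG : ContDiff ℝ (⊤ : ℕ∞) (fun q : ℝ × ℝ => G q.1 q.2)) (t x : ℝ) :
    HasDerivAt (fun s => G s x) (deriv (fun s => G s x) t) t :=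
  (hasDerivAt_fst_fderiv hG t x).differentiableAt.hasDerivAt

lemma continuous_of_contDiff (hG : ContDiff ℝ (⊤ : ℕ∞) (fun q : ℝ × ℝ => G q.1 q.2)) (t : ℝ) :
    Continuous (G t) :=
  hG.continuous.comp (Continuous.prodMk_right t)

lemma deriv_fst_deriv_snd (hG : ContDiff ℝ (⊤ : ℕ∞) (fun q : ℝ × ℝ => G q.1 q.2)) (t x : ℝ) :
    deriv (fun s => deriv (G s) x) t = deriv (fun y => deriv (fun s => G s y) t) x := by
  have hd : DifferentiableAt ℝ (fderiv ℝ (fun q : ℝ × ℝ => G q.1 q.2)) (t, x) :=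
    ((hG.fderiv_right (m := (⊤ : ℕ∞)) (by simp)).differentiable (by simp)) (t, x)
  have hsymm : IsSymmSndFDerivAt ℝ (fun q : ℝ × ℝ => G q.1 q.2) (t, x) :=
    hG.contDiffAt.isSymmSndFDerivAt (by
      rw [minSmoothness_of_isRCLikeNormedField]
      exact WithTop.coe_le_coe.2 le_top)
  simp only [(hasDerivAt_snd_fderiv hG _ _).deriv, (hasDerivAt_fst_fderiv hG _ _).deriv]
  have key (v : ℝ × ℝ) : fderiv ℝ (fun q => fderiv ℝ (fun q : ℝ × ℝ => G q.1 q.2) q v) (t, x)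
      = (fderiv ℝ (fderiv ℝ (fun q : ℝ × ℝ => G q.1 q.2)) (t, x)).flip v := by
    rw [fderiv_clm_apply hd (differentiableAt_const v)]
    simp
  rw [(hasDerivAt_fst_fderiv (G := fun s y => fderiv ℝ (fun q : ℝ × ℝ => G q.1 q.2) (s, y) (0, 1))
      (contDiff_fderiv_apply hG _) t x).deriv,
    (hasDerivAt_snd_fderiv (G := fun s y => fderiv ℝ (fun q : ℝ × ℝ => G q.1 q.2) (s, y) (1, 0))
      (contDiff_fderiv_apply hG _) t x).deriv]
  simp only [Prod.mk.eta, key, ContinuousLinearMap.flip_apply]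
  exact hsymm _ _

end JointlySmooth

/-- `g t` decays faster than every negative power of `1 + |x|`, uniformly for `t ∈ S`. -/
def RapidlyDecayingOn (S : Set ℝ) (g : ℝ → ℝ → ℝ) : Prop :=
  ∀ n : ℕ, ∃ M : ℝ, ∀ t ∈ S, ∀ x : ℝ, (1 + |x|) ^ n * |g t x| ≤ M

namespace RapidlyDecayingOn

variable {S : Set ℝ} {g h : ℝ → ℝ → ℝ}

lemma add (hg : RapidlyDecayingOn S g) (hh : RapidlyDecayingOn S h) :
    RapidlyDecayingOn S (fun t x => g t x + h t x) := fun n => by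
  obtain ⟨M, hM⟩ := hg n
  obtain ⟨N, hN⟩ := hh n
  refine ⟨M + N, fun t ht x => ?_⟩
  have : (1 + |x|) ^ n * |g t x + h t x| ≤ (1 + |x|) ^ n * (|g t x| + |h t x|) := by
    gcongr
    exact abs_add_le _ _
  linarith [hM t ht x, hN t ht x]

lemma bounded_mul (hg : RapidlyDecayingOn S g) (hh : ∃ C, ∀ t ∈ S, ∀ x, |h t x| ≤ C) :
    RapidlyDecayingOn S (fun t x => h t x * g t x) := fun n => by
  obtain ⟨M, hM⟩ := hg n
  obtain ⟨C, hC⟩ := hh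
  refine ⟨C * M, fun t ht x => ?_⟩
  calc (1 + |x|) ^ n * |h t x * g t x| = |h t x| * ((1 + |x|) ^ n * |g t x|) := by
        rw [abs_mul]; ring
    _ ≤ C * M := mul_le_mul (hC t ht x) (hM t ht x) (by positivity)
        ((abs_nonneg _).trans (hC t ht x))

lemma bounded (hg : RapidlyDecayingOn S g) : ∃ C, ∀ t ∈ S, ∀ x, |g t x| ≤ C := by
  simpa using hg 0

lemma mul (hh : RapidlyDecayingOn S h) (hg : RapidlyDecayingOn S g) :
    RapidlyDecayingOn S (fun t x => h t x * g t x) :=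
  hg.bounded_mul hh.bounded

lemma const_mul (hg : RapidlyDecayingOn S g) (c : ℝ) :
    RapidlyDecayingOn S (fun t x => c * g t x) :=
  hg.bounded_mul (h := fun _ _ => c) ⟨|c|, fun _ _ _ => le_rfl⟩

lemma sub (hg : RapidlyDecayingOn S g) (hh : RapidlyDecayingOn S h) :
    RapidlyDecayingOn S (fun t x => g t x - h t x) := by
  simpa [sub_eq_add_neg] using hg.add (hh.const_mul (-1))

lemma id_mul (hg : RapidlyDecayingOn S g) : RapidlyDecayingOn S (fun t x => x * g t x) :=
    fun n => by
  obtain ⟨M, hM⟩ := hg (n + 1)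
  refine ⟨M, fun t ht x => le_trans ?_ (hM t ht x)⟩
  rw [abs_mul, pow_succ, mul_assoc]
  gcongr
  linarith

lemma comp (hg : RapidlyDecayingOn S g) {F : ℝ → ℝ} (hF : ContDiff ℝ 1 F) (hF0 : F 0 = 0) :
    RapidlyDecayingOn S (fun t x => F (g t x)) := by
  obtain ⟨B, hB⟩ := hg.bounded
  obtain ⟨C, hC⟩ := (isCompact_Icc (a := -B) (b := B)).exists_bound_of_continuousOn
    (hF.continuous_deriv le_rfl).continuousOn
  intro n
  obtain ⟨M, hM⟩ := hg n
  refine ⟨C * M, fun t ht x => ?_⟩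
  have hgB := abs_le.1 (hB t ht x)
  have hB0 : 0 ≤ B := (abs_nonneg _).trans (hB t ht x)
  have h0 : (0 : ℝ) ∈ Set.Icc (-B) B := ⟨by linarith, hB0⟩
  have hFg : |F (g t x)| ≤ C * |g t x| := by
    simpa [hF0] using (convex_Icc (-B) B).norm_image_sub_le_of_norm_deriv_le
      (fun y _ => hF.differentiable (by simp) y) hC h0 hgB
  calc (1 + |x|) ^ n * |F (g t x)| ≤ (1 + |x|) ^ n * (C * |g t x|) := by gcongr
    _ = C * ((1 + |x|) ^ n * |g t x|) := by ring
    _ ≤ C * M := mul_le_mul_of_nonneg_left (hM t ht x) ((norm_nonneg _).trans (hC 0 h0))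

lemma exists_le_mul_inv_one_add_sq (hg : RapidlyDecayingOn S g) :
    ∃ M, ∀ t ∈ S, ∀ x, |g t x| ≤ M * (1 + x ^ 2)⁻¹ := by
  obtain ⟨M, hM⟩ := hg 2
  refine ⟨M, fun t ht x => ?_⟩
  rw [← div_eq_mul_inv, le_div_iff₀ (by positivity), mul_comm]
  refine le_trans ?_ (hM t ht x)
  gcongr
  nlinarith [abs_nonneg x, sq_abs x]

lemma integrable (hg : RapidlyDecayingOn S g) {t : ℝ} (ht : t ∈ S) (hc : Continuous (g t)) :
    Integrable (g t) := by
  obtain ⟨M, hM⟩ := hg.exists_le_mul_inv_one_add_sq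
  exact (integrable_inv_one_add_sq.const_mul M).mono' hc.aestronglyMeasurable
    (Eventually.of_forall (hM t ht))

end RapidlyDecayingOn

lemma contDiff_sech : ContDiff ℝ (⊤ : ℕ∞) sech :=
  contDiff_const.div Real.contDiff_cosh fun x => (Real.cosh_pos x).ne'

lemma hasDerivAt_sech_pow_four (x : ℝ) :
    HasDerivAt (fun s => sech s ^ 4) (-4 * (Real.sinh x / Real.cosh x ^ 5)) x := by
  have hc := (Real.cosh_pos x).ne'
  have := (((hasDerivAt_const x (1 : ℝ)).div (Real.hasDerivAt_cosh x) hc).pow 4)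
  refine this.congr_deriv ?_
  simp
  field_simp

lemma hasDerivAt_sinh_div_cosh_pow (x : ℝ) :
    HasDerivAt (fun s => -4 * (Real.sinh s / Real.cosh s ^ 5))
      (-4 * (1 / Real.cosh x ^ 4 - 5 * (Real.sinh x ^ 2 / Real.cosh x ^ 6))) x := by
  have hc := (Real.cosh_pos x).ne'
  have := (((Real.hasDerivAt_sinh x).div ((Real.hasDerivAt_cosh x).pow 5)
    (pow_ne_zero 5 hc)).const_mul (-4))
  refine this.congr_deriv ?_
  simp
  field_simp

lemma abs_sinh_le_cosh (x : ℝ) : |Real.sinh x| ≤ Real.cosh x :=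
  abs_le_of_sq_le_sq (by nlinarith [Real.cosh_sq x]) (Real.cosh_pos x).le

lemma abs_sech_pow_four_le (x : ℝ) : |sech x ^ 4| ≤ 1 := by
  have h : 0 ≤ sech x := by unfold sech; positivity
  rw [abs_of_nonneg (by positivity)]
  exact pow_le_one₀ h (by
    unfold sech
    exact (div_le_one (Real.cosh_pos x)).2 (Real.one_le_cosh x))

lemma abs_deriv_sech_pow_four_le (x : ℝ) : |deriv (fun s => sech s ^ 4) x| ≤ 4 := by
  rw [(hasDerivAt_sech_pow_four x).deriv, abs_mul, abs_div, abs_of_pos (by positivity :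
    0 < Real.cosh x ^ 5)]
  have : |Real.sinh x| / Real.cosh x ^ 5 ≤ 1 := (div_le_one (by positivity)).2
    ((abs_sinh_le_cosh x).trans (le_self_pow₀ (Real.one_le_cosh x) (by norm_num)))
  norm_num
  linarith

lemma abs_deriv_deriv_sech_pow_four_le (x : ℝ) :
    |deriv (deriv fun s => sech s ^ 4) x| ≤ 24 := by
  rw [funext fun y => (hasDerivAt_sech_pow_four y).deriv, (hasDerivAt_sinh_div_cosh_pow x).deriv]
  have h₁ : 1 / Real.cosh x ^ 4 ≤ 1 := (div_le_one (by positivity)).2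
    (one_le_pow₀ (Real.one_le_cosh x))
  have h₂ : Real.sinh x ^ 2 / Real.cosh x ^ 6 ≤ 1 := (div_le_one (by positivity)).2 <| by
    calc Real.sinh x ^ 2 ≤ Real.cosh x ^ 2 := by nlinarith [Real.cosh_sq x]
      _ ≤ Real.cosh x ^ 6 := pow_le_pow_right₀ (Real.one_le_cosh x) (by norm_num)
  have h₃ : 0 ≤ 1 / Real.cosh x ^ 4 := by positivity
  have h₄ : 0 ≤ Real.sinh x ^ 2 / Real.cosh x ^ 6 := by positivity
  rw [abs_le]
  constructor <;> linarith

lemma RapidlyDecayingOn.hasDerivAt_integral {S : Set ℝ} {e e' : ℝ → ℝ → ℝ} {t : ℝ}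
    (hS : S ∈ nhds t) (he : RapidlyDecayingOn S e) (he' : RapidlyDecayingOn S e')
    (hc : ∀ s, Continuous (e s)) (hc' : Continuous (e' t))
    (hd : ∀ s ∈ S, ∀ x, HasDerivAt (fun s => e s x) (e' s x) s) :
    HasDerivAt (fun s => ∫ x, e s x) (∫ x, e' t x) t := by
  obtain ⟨M, hM⟩ := he'.exists_le_mul_inv_one_add_sq
  exact (hasDerivAt_integral_of_dominated_loc_of_deriv_le hS
    (Eventually.of_forall fun s => (hc s).aestronglyMeasurable)
    (he.integrable (mem_of_mem_nhds hS) (hc t)) hc'.aestronglyMeasurable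
    (Eventually.of_forall fun x s hs => hM s hs x) (integrable_inv_one_add_sq.const_mul M)
    (Eventually.of_forall fun x s hs => hd s hs x)).2

lemma hasDerivAt_integral_comp_div_mul {φ lam : ℝ → ℝ} {T t : ℝ} {E E' : ℝ → ℝ → ℝ}
    (hφ : ContDiff ℝ 1 φ) (hφb : ∃ C, ∀ x, |φ x| ≤ C) (hφb' : ∃ C, ∀ x, |deriv φ x| ≤ C)
    (hlam : ContDiff ℝ 1 lam) (hlam0 : ∀ s, lam s ≠ 0) (ht : t ∈ Set.Ioo (-T) T)
    (hE : RapidlyDecayingOn (Set.Icc (-T) T) E) (hE' : RapidlyDecayingOn (Set.Icc (-T) T) E')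
    (hc : ∀ s, Continuous (E s)) (hc' : Continuous (E' t))
    (hd : ∀ s x, HasDerivAt (fun s => E s x) (E' s x) s) :
    HasDerivAt (fun s => ∫ x, φ (x / lam s) * E s x)
      (-(deriv lam t / lam t) * (∫ x, x / lam t * deriv φ (x / lam t) * E t x)
        + ∫ x, φ (x / lam t) * E' t x) t := by
  obtain ⟨C, hC⟩ := hφb
  obtain ⟨C', hC'⟩ := hφb'
  have hφ' := hφ.continuous_deriv le_rfl
  have hlam' := hlam.continuous_deriv le_rfl
  have hφd (y : ℝ) : HasDerivAt φ (deriv φ y) y := (hφ.differentiable (by simp) y).hasDerivAt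
  have hlamd (s : ℝ) : HasDerivAt lam (deriv lam s) s :=
    (hlam.differentiable (by simp) s).hasDerivAt
  have hφE : RapidlyDecayingOn (Set.Icc (-T) T) (fun s x => φ (x / lam s) * E s x) :=
    hE.bounded_mul ⟨C, fun s _ x => hC _⟩
  have hφE' : RapidlyDecayingOn (Set.Icc (-T) T) (fun s x => φ (x / lam s) * E' s x) :=
    hE'.bounded_mul ⟨C, fun s _ x => hC _⟩
  have hxE : RapidlyDecayingOn (Set.Icc (-T) T)
      (fun s x => (lam s)⁻¹ * (deriv φ (x / lam s) * (x * E s x))) := by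
    obtain ⟨L, hL⟩ := (isCompact_Icc (a := -T) (b := T)).exists_bound_of_continuousOn
      (hlam.continuous.inv₀ hlam0).continuousOn
    exact (hE.id_mul.bounded_mul ⟨C', fun s _ x => hC' _⟩).bounded_mul ⟨L, fun s hs _ => hL s hs⟩
  have hdE : RapidlyDecayingOn (Set.Icc (-T) T) (fun s x => -(deriv lam s / lam s) *
      ((lam s)⁻¹ * (deriv φ (x / lam s) * (x * E s x)))) := by
    obtain ⟨L, hL⟩ := (isCompact_Icc (a := -T) (b := T)).exists_bound_of_continuousOn
      (hlam'.div hlam.continuous hlam0).neg.continuousOn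
    exact hxE.bounded_mul ⟨L, fun s hs _ => hL s hs⟩
  have htI := Set.Ioo_subset_Icc_self ht
  have hint₁ := hxE.integrable htI (by have := hc t; fun_prop)
  have hint₂ := hφE'.integrable htI (by have := hφ.continuous; fun_prop)
  refine (RapidlyDecayingOn.hasDerivAt_integral (Icc_mem_nhds ht.1 ht.2) hφE (hdE.add hφE')
    (fun s => ?_) ?_ fun s _ x => ?_).congr_deriv ?_
  · have := hφ.continuous
    have := hc s
    fun_prop
  · have := hφ.continuous
    have := hc t
    fun_prop
  · have h := ((hφd (x / lam s)).comp s
      ((hasDerivAt_const s x).div (hlamd s) (hlam0 s))).mul (hd s x)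
    refine h.congr_deriv ?_
    have := hlam0 s
    simp only [Function.comp_apply, Pi.div_apply]
    field_simp
    ring
  · rw [integral_add (hint₁.const_mul _) hint₂, integral_const_mul]
    refine congrArg₂ _ (congrArg _ (congrArg _ (funext fun x => ?_))) rfl
    ring

lemma integral_comp_div_mul_deriv {φ W W' : ℝ → ℝ} (ℓ : ℝ)
    (hφ : ContDiff ℝ 1 φ) (hφb : ∃ C, ∀ x, |φ x| ≤ C) (hφb' : ∃ C, ∀ x, |deriv φ x| ≤ C)
    (hW : ∀ x, HasDerivAt W (W' x) x) (hWi : Integrable W) (hWi' : Integrable W') :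
    ∫ x, φ (x / ℓ) * W' x = -(1 / ℓ) * ∫ x, deriv φ (x / ℓ) * W x := by
  obtain ⟨C, hC⟩ := hφb
  obtain ⟨C', hC'⟩ := hφb'
  have hφc := hφ.continuous
  have hφc' := hφ.continuous_deriv le_rfl
  have hd (x : ℝ) : HasDerivAt (fun x => φ (x / ℓ)) (deriv φ (x / ℓ) * (1 / ℓ)) x :=
    (hφ.differentiable (by simp) (x / ℓ)).hasDerivAt.comp x ((hasDerivAt_id x).div_const ℓ)
  have h₀ : Integrable fun x => φ (x / ℓ) * W x :=
    hWi.bdd_mul (c := C) (by fun_prop) (Eventually.of_forall fun x => hC _)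
  have h₁ : Integrable fun x => φ (x / ℓ) * W' x :=
    hWi'.bdd_mul (c := C) (by fun_prop) (Eventually.of_forall fun x => hC _)
  have h₂ : Integrable fun x => deriv φ (x / ℓ) * (1 / ℓ) * W x := by
    have : Integrable fun x => deriv φ (x / ℓ) * W x :=
      hWi.bdd_mul (c := C') (by fun_prop) (Eventually.of_forall fun x => hC' _)
    exact (this.const_mul (1 / ℓ)).congr (Eventually.of_forall fun x => by ring)
  rw [integral_mul_deriv_eq_deriv_mul_of_integrable (fun x _ => hd x) (fun x _ => hW x) h₁ h₂ h₀,
    ← integral_neg, ← integral_const_mul]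
  congr! 2 with x
  ring

/-- Third energy identity \eqref{final_1}, with $\phi_1 = \mathrm{sech}^4$. -/
theorem stmt_15 (p K : ℝ) (hp : 1 < p) (hK : 0 < K)
    (f : ℝ → ℝ) (hf : ContDiff ℝ (⊤ : ℕ∞) f) (hf0 : f 0 = 0)
    (hfp : ∀ s : ℝ, |s| ≤ 1 → |deriv f s| ≤ K * |s| ^ (p - 1))
    (u₁ u₂ : ℝ → ℝ → ℝ)
    (hu₁ : ContDiff ℝ (⊤ : ℕ∞) (fun q : ℝ × ℝ => u₁ q.1 q.2))
    (hu₂ : ContDiff ℝ (⊤ : ℕ∞) (fun q : ℝ × ℝ => u₂ q.1 q.2))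
    (heq₁ : ∀ t x : ℝ, deriv (fun s => u₁ s x) t = deriv (u₂ t) x)
    (heq₂ : ∀ t x : ℝ, deriv (fun s => u₂ s x) t
      = deriv (fun y => u₁ t y - deriv (deriv (u₁ t)) y - f (u₁ t y)) x)
    (hdec₁ : ∀ T : ℝ, ∀ m k n : ℕ, ∃ M : ℝ, ∀ t ∈ Set.Icc (-T) T, ∀ x : ℝ,
      (1 + |x|) ^ n * |iteratedDeriv k (fun y => iteratedDeriv m (fun s => u₁ s y) t) x| ≤ M)
    (hdec₂ : ∀ T : ℝ, ∀ m k n : ℕ, ∃ M : ℝ, ∀ t ∈ Set.Icc (-T) T, ∀ x : ℝ,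
      (1 + |x|) ^ n * |iteratedDeriv k (fun y => iteratedDeriv m (fun s => u₂ s y) t) x| ≤ M)
    (lam : ℝ → ℝ) (hlam : ContDiff ℝ (⊤ : ℕ∞) lam) (hlampos : ∀ t : ℝ, 0 < lam t)
    (φ₁ : ℝ → ℝ) (hφ₁ : φ₁ = fun s => sech s ^ 4)
    (F : ℝ → ℝ) (hF : ∀ s : ℝ, F s = ∫ r in (0:ℝ)..s, f r) :
    ∀ t : ℝ, HasDerivAt (fun s => (1 / 2) * ∫ x : ℝ, φ₁ (x / lam s) *
        ((deriv (u₁ s) x) ^ 2 + (u₁ s x) ^ 2 + (u₂ s x) ^ 2 - 2 * F (u₁ s x)))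
      (-(deriv lam t / (2 * lam t)) * (∫ x : ℝ, (x / lam t) * deriv φ₁ (x / lam t) *
            ((deriv (u₁ t) x) ^ 2 + (u₁ t x) ^ 2 + (u₂ t x) ^ 2 - 2 * F (u₁ t x)))
        + (2 / lam t) * (∫ x : ℝ, deriv φ₁ (x / lam t) * (u₂ t x * deriv (deriv (u₁ t)) x))
        + (1 / (lam t) ^ 2) * (∫ x : ℝ, deriv (deriv φ₁) (x / lam t) * (deriv (u₁ t) x * u₂ t x))
        - (1 / lam t) * (∫ x : ℝ, deriv φ₁ (x / lam t) * (u₁ t x * u₂ t x))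
        + (1 / lam t) * (∫ x : ℝ, deriv φ₁ (x / lam t) * (u₂ t x * f (u₁ t x)))) t := by
  intro t
  have hφ : ContDiff ℝ (⊤ : ℕ∞) φ₁ := hφ₁ ▸ contDiff_sech.pow 4
  have hφ' : ContDiff ℝ (⊤ : ℕ∞) (deriv φ₁) := by
    have : ContDiff ℝ ((⊤ : ℕ∞) + 1) φ₁ := hφ
    exact (contDiff_succ_iff_deriv.1 this).2.2
  have hφb : ∃ C, ∀ x, |φ₁ x| ≤ C := ⟨1, hφ₁ ▸ abs_sech_pow_four_le⟩
  have hφb' : ∃ C, ∀ x, |deriv φ₁ x| ≤ C := ⟨4, hφ₁ ▸ abs_deriv_sech_pow_four_le⟩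
  have hφb'' : ∃ C, ∀ x, |deriv (deriv φ₁) x| ≤ C :=
    ⟨24, hφ₁ ▸ abs_deriv_deriv_sech_pow_four_le⟩
  have hFd (s : ℝ) : HasDerivAt F (f s) s := by
    rw [funext hF]
    exact (hf.continuous.integral_hasStrictDerivAt 0 s).hasDerivAt
  have hF0 : F 0 = 0 := by simp [hF]
  have hFC : ContDiff ℝ 1 F := contDiff_one_iff_deriv.2
    ⟨fun s => (hFd s).differentiableAt, by
      simpa only [funext fun s => (hFd s).deriv] using hf.continuous⟩
  have hFc := hFC.continuous
  have hfc := hf.continuous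
  obtain ⟨T, hT⟩ : ∃ T : ℝ, t ∈ Set.Ioo (-T) T :=
    ⟨|t| + 1, by linarith [neg_abs_le t], by linarith [le_abs_self t]⟩
  have htI := Set.Ioo_subset_Icc_self hT
  have ha : RapidlyDecayingOn (Set.Icc (-T) T) u₁ := fun n => by simpa using hdec₁ T 0 0 n
  have hax : RapidlyDecayingOn (Set.Icc (-T) T) (fun t => deriv (u₁ t)) := fun n => by
    simpa using hdec₁ T 0 1 n
  have haxx : RapidlyDecayingOn (Set.Icc (-T) T) (fun t => deriv (deriv (u₁ t))) := fun n => by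
    simpa [iteratedDeriv_succ] using hdec₁ T 0 2 n
  have hb : RapidlyDecayingOn (Set.Icc (-T) T) u₂ := fun n => by simpa using hdec₂ T 0 0 n
  have hbx : RapidlyDecayingOn (Set.Icc (-T) T) (fun t => deriv (u₂ t)) := fun n => by
    simpa using hdec₂ T 0 1 n
  have hbxx : RapidlyDecayingOn (Set.Icc (-T) T) (fun t => deriv (deriv (u₂ t))) := fun n => by
    simpa [iteratedDeriv_succ] using hdec₂ T 0 2 n
  have hbt : RapidlyDecayingOn (Set.Icc (-T) T) (fun t x => deriv (fun s => u₂ s x) t) :=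
    fun n => by simpa using hdec₂ T 1 0 n
  have hFa := ha.comp hFC hF0
  have hfa := ha.comp (hf.of_le (by simp)) hf0
  have hu₁x := contDiff_deriv_snd hu₁
  have hu₁xx := contDiff_deriv_snd (G := fun t => deriv (u₁ t)) hu₁x
  have hu₂x := contDiff_deriv_snd hu₂
  have hu₂xx := contDiff_deriv_snd (G := fun t => deriv (u₂ t)) hu₂x
  have ca (s : ℝ) := continuous_of_contDiff hu₁ s
  have cax (s : ℝ) : Continuous (deriv (u₁ s)) :=
    continuous_of_contDiff (G := fun s => deriv (u₁ s)) hu₁x s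
  have caxx (s : ℝ) : Continuous (deriv (deriv (u₁ s))) :=
    continuous_of_contDiff (G := fun s => deriv (deriv (u₁ s))) hu₁xx s
  have cb (s : ℝ) := continuous_of_contDiff hu₂ s
  have cbx (s : ℝ) : Continuous (deriv (u₂ s)) :=
    continuous_of_contDiff (G := fun s => deriv (u₂ s)) hu₂x s
  have cbxx (s : ℝ) : Continuous (deriv (deriv (u₂ s))) :=
    continuous_of_contDiff (G := fun s => deriv (deriv (u₂ s))) hu₂xx s
  have cbt (s : ℝ) : Continuous (fun x => deriv (fun r => u₂ r x) s) :=
    continuous_of_contDiff (G := fun s x => deriv (fun r => u₂ r x) s) (contDiff_deriv_fst hu₂) s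
  have hax_t (s x : ℝ) : HasDerivAt (fun r => deriv (u₁ r) x) (deriv (deriv (u₂ s)) x) s := by
    have h := hasDerivAt_fst (G := fun r => deriv (u₁ r)) hu₁x s x
    rw [deriv_fst_deriv_snd hu₁] at h
    simpa only [heq₁] using h
  have ha_t (s x : ℝ) : HasDerivAt (fun r => u₁ r x) (deriv (u₂ s) x) s :=
    heq₁ s x ▸ hasDerivAt_fst hu₁ s x
  have hE : RapidlyDecayingOn (Set.Icc (-T) T) (fun s x =>
      (deriv (u₁ s) x) ^ 2 + (u₁ s x) ^ 2 + (u₂ s x) ^ 2 - 2 * F (u₁ s x)) := by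
    simpa only [sq] using (((hax.mul hax).add (ha.mul ha)).add (hb.mul hb)).sub (hFa.const_mul 2)
  set g : ℝ → ℝ → ℝ := fun s y => u₁ s y - deriv (deriv (u₁ s)) y - f (u₁ s y) with hg_def
  have hg : RapidlyDecayingOn (Set.Icc (-T) T) g := (ha.sub haxx).sub hfa
  have hW : RapidlyDecayingOn (Set.Icc (-T) T) (fun s x =>
      u₂ s x * g s x + deriv (u₁ s) x * deriv (u₂ s) x) := (hb.mul hg).add (hax.mul hbx)
  have hW' : RapidlyDecayingOn (Set.Icc (-T) T) (fun s x =>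
      deriv (u₂ s) x * g s x + u₂ s x * deriv (fun r => u₂ r x) s
        + (deriv (deriv (u₁ s)) x * deriv (u₂ s) x + deriv (u₁ s) x * deriv (deriv (u₂ s)) x)) :=
    ((hbx.mul hg).add (hb.mul hbt)).add ((haxx.mul hbx).add (hax.mul hbxx))
  have cg (s : ℝ) : Continuous (g s) := by
    have := ca s
    have := caxx s
    fun_prop
  have hWd (x : ℝ) : HasDerivAt (fun x => u₂ t x * g t x + deriv (u₁ t) x * deriv (u₂ t) x)
      (deriv (u₂ t) x * g t x + u₂ t x * deriv (fun r => u₂ r x) t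
        + (deriv (deriv (u₁ t)) x * deriv (u₂ t) x + deriv (u₁ t) x * deriv (deriv (u₂ t)) x)) x := by
    have hgd : HasDerivAt (g t) (deriv (fun r => u₂ r x) t) x := by
      rw [heq₂]
      exact DifferentiableAt.hasDerivAt (((hasDerivAt_snd hu₁ t x).differentiableAt.sub
        (hasDerivAt_snd (G := fun s => deriv (deriv (u₁ s))) hu₁xx t x).differentiableAt).sub
        ((hf.differentiable (by simp) _).comp x
        (hasDerivAt_snd hu₁ t x).differentiableAt))
    exact ((hasDerivAt_snd hu₂ t x).mul hgd).add
      ((hasDerivAt_snd (G := fun s => deriv (u₁ s)) hu₁x t x).mul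
        (hasDerivAt_snd (G := fun s => deriv (u₂ s)) hu₂x t x))
  have hd := hasDerivAt_integral_comp_div_mul (hφ.of_le (by simp)) hφb hφb' (hlam.of_le (by simp))
    (fun s => (hlampos s).ne') hT hE (hW'.const_mul 2)
    (fun s => by
      have := ca s
      have := cax s
      have := cb s
      fun_prop)
    (by
      have := cax t
      have := caxx t
      have := cb t
      have := cbx t
      have := cbxx t
      have := cbt t
      have := cg t
      fun_prop)
    (fun s x => by
      refine (((((hax_t s x).pow 2).add ((ha_t s x).pow 2)).add
        ((hasDerivAt_fst hu₂ s x).pow 2)).sub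
        (((hFd (u₁ s x)).comp s (ha_t s x)).const_mul 2)).congr_deriv ?_
      simp only [hg_def]
      push_cast
      ring)
  have cat := ca t
  have caxt := cax t
  have caxxt := caxx t
  have cbT := cb t
  have cbxt := cbx t
  have cbxxt := cbxx t
  have cbtt := cbt t
  have cgt := cg t
  have hψ := hφ'.continuous
  have hparts₁ := integral_comp_div_mul_deriv (lam t) (hφ.of_le (by simp)) hφb hφb' hWd
    (hW.integrable htI (by fun_prop)) (hW'.integrable htI (by fun_prop))
  have hparts₂ := integral_comp_div_mul_deriv (lam t) (hφ'.of_le (by simp)) hφb' hφb''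
    (fun x => (hasDerivAt_snd (G := fun s => deriv (u₁ s)) hu₁x t x).mul (hasDerivAt_snd hu₂ t x))
    ((hax.mul hb).integrable htI (by fun_prop))
    (((haxx.mul hb).add (hax.mul hbx)).integrable htI (by fun_prop))
  have weighted {h : ℝ → ℝ → ℝ} (hh : RapidlyDecayingOn (Set.Icc (-T) T) h)
      (hc : Continuous (h t)) : Integrable fun x => deriv φ₁ (x / lam t) * h t x :=
    (hh.bounded_mul (h := fun s x => deriv φ₁ (x / lam s))
      (hφb'.imp fun _ hC _ _ _ => hC _)).integrable htI (by fun_prop)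
  have i₁ := weighted (hb.mul haxx) (by fun_prop)
  have i₂ := weighted (ha.mul hb) (by fun_prop)
  have i₃ := weighted (hb.mul hfa) (by fun_prop)
  have i₄ := weighted (hax.mul hbx) (by fun_prop)
  have hsplit₁ : ∫ x, deriv φ₁ (x / lam t) *
      (u₂ t x * g t x + deriv (u₁ t) x * deriv (u₂ t) x)
      = (∫ x, deriv φ₁ (x / lam t) * (u₁ t x * u₂ t x))
        - (∫ x, deriv φ₁ (x / lam t) * (u₂ t x * deriv (deriv (u₁ t)) x))
        - (∫ x, deriv φ₁ (x / lam t) * (u₂ t x * f (u₁ t x)))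
        + ∫ x, deriv φ₁ (x / lam t) * (deriv (u₁ t) x * deriv (u₂ t) x) := by
    rw [← integral_sub' i₂ i₁, ← integral_sub' (i₂.sub i₁) i₃,
      ← integral_add' ((i₂.sub i₁).sub i₃) i₄]
    refine integral_congr_ae (Eventually.of_forall fun x => ?_)
    simp only [hg_def, Pi.sub_apply, Pi.add_apply]
    ring
  have hsplit₂ : ∫ x, deriv φ₁ (x / lam t) *
      (deriv (deriv (u₁ t)) x * u₂ t x + deriv (u₁ t) x * deriv (u₂ t) x)
      = (∫ x, deriv φ₁ (x / lam t) * (u₂ t x * deriv (deriv (u₁ t)) x))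
        + ∫ x, deriv φ₁ (x / lam t) * (deriv (u₁ t) x * deriv (u₂ t) x) := by
    rw [← integral_add i₁ i₄]
    refine integral_congr_ae (Eventually.of_forall fun x => ?_)
    ring
  have htwo : ∫ x, φ₁ (x / lam t) * (2 * (deriv (u₂ t) x * g t x
      + u₂ t x * deriv (fun r => u₂ r x) t + (deriv (deriv (u₁ t)) x * deriv (u₂ t) x
        + deriv (u₁ t) x * deriv (deriv (u₂ t)) x)))
      = 2 * ∫ x, φ₁ (x / lam t) * (deriv (u₂ t) x * g t x
      + u₂ t x * deriv (fun r => u₂ r x) t + (deriv (deriv (u₁ t)) x * deriv (u₂ t) x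
        + deriv (u₁ t) x * deriv (deriv (u₂ t)) x)) := by
    rw [← integral_const_mul]
    refine integral_congr_ae (Eventually.of_forall fun x => ?_)
    ring
  refine (hd.const_mul (1 / 2)).congr_deriv ?_
  rw [htwo, hparts₁, hsplit₁]
  have hcross := hsplit₂.symm.trans hparts₂
  simp only [Pi.mul_apply] at hcross
  rw [← eq_sub_iff_add_eq'] at hcross
  rw [hcross]
  have := (hlampos t).ne'
  field_simp
  ring
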